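/- Let A_k be the 6×6 integer matrix with rows (-1,-1,0,0,-1,0), (0,-1,0,0,-1,0), (0,0,1,1,1,0), (0,0,0,1,1,0), (0,0,0,0,0,0), (0,0,0,0,1,-k), and let ω = e^{iπ/3}. Then for every integer k ≥ 2, the Hermitian matrix M_k = (1-ω)·A_k + (1-ω̄)·A_kᵀ has signature equal to -1, i.e., the number of positive eigenvalues of M_k minus the number of negative eigenvalues of M_k (counted with multiplicity) equals -1. -/

import Mathlib

open Matrix Complex Finset

def A (k : ℤ) : Matrix (Fin 6) (Fin 6) ℤ :=
  !![-1,-1,0,0,-1,0; 0,-1,0,0,-1,0; 0,0,1,1,1,0; 0,0,0,1,1,0; 0,0,0,0,0,0; 0,0,0,0,1,-k]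

noncomputable def ω : ℂ := Complex.exp (Real.pi / 3 * Complex.I)

noncomputable def M (k : ℤ) : Matrix (Fin 6) (Fin 6) ℂ :=
  (1 - ω) • (A k).map (fun x => (x : ℂ)) +
    (1 - (starRingEnd ℂ) ω) • ((A k).map (fun x => (x : ℂ)))ᵀ

/-- The signature of a Hermitian matrix: number of positive eigenvalues minus
number of negative eigenvalues, counted with multiplicity. -/
noncomputable def signature {n : Type*} [Fintype n] [DecidableEq n]
    {N : Matrix n n ℂ} (hN : N.IsHermitian) : ℤ :=
  ((univ.filter fun i => 0 < hN.eigenvalues i).card : ℤ) -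
    ((univ.filter fun i => hN.eigenvalues i < 0).card : ℤ)

lemma card_lower {p : ℕ} {N : Matrix (Fin 6) (Fin 6) ℂ} (hN : N.IsHermitian) (s : ℝ)
    (P : Matrix (Fin 6) (Fin p) ℂ) (d : Fin p → ℝ) (hd : ∀ j, 0 < s * d j)
    (hP : Pᴴ * (N * P) = diagonal (fun j => (d j : ℂ))) :
    p ≤ (univ.filter fun i => 0 < s * hN.eigenvalues i).card := by
  by_contra! hlt
  set U : Matrix (Fin 6) (Fin 6) ℂ := (hN.eigenvectorUnitary : Matrix (Fin 6) (Fin 6) ℂ) with hU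
  have hspec : N = U * diagonal (fun i => (hN.eigenvalues i : ℂ)) * Uᴴ := by
    have h := hN.spectral_theorem
    rw [Unitary.conjStarAlgAut_apply] at h
    exact h
  set Q : Matrix (Fin 6) (Fin p) ℂ := Uᴴ * P with hQ
  have hQQ : Qᴴ * (diagonal (fun i => (hN.eigenvalues i : ℂ)) * Q) =
      diagonal (fun j => (d j : ℂ)) := by
    rw [← hP, hQ, conjTranspose_mul, conjTranspose_conjTranspose]
    conv_rhs => rw [hspec]
    simp only [Matrix.mul_assoc]
  let S := {i : Fin 6 // 0 < s * hN.eigenvalues i}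
  let R : Matrix S (Fin p) ℂ := Q.submatrix Subtype.val id
  have hker : LinearMap.ker (Matrix.mulVecLin R) ≠ ⊥ := by
    apply LinearMap.ker_ne_bot_of_finrank_lt
    simpa [S, Fintype.card_subtype] using hlt
  obtain ⟨y, hy, hy0⟩ := (Submodule.ne_bot_iff _).1 hker
  have hz : ∀ i, 0 < s * hN.eigenvalues i → (Q *ᵥ y) i = 0 := by
    intro i hi
    have := congrFun (LinearMap.mem_ker.1 hy) ⟨i, hi⟩
    exact this
  have h1 : star (Q *ᵥ y) ⬝ᵥ (diagonal (fun i => (hN.eigenvalues i : ℂ)) *ᵥ (Q *ᵥ y)) =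
      star y ⬝ᵥ (diagonal (fun j => (d j : ℂ)) *ᵥ y) := by
    rw [← hQQ, star_mulVec, ← dotProduct_mulVec, mulVec_mulVec, mulVec_mulVec, Matrix.mul_assoc]
  have h2 : ∑ i, hN.eigenvalues i * normSq ((Q *ᵥ y) i) = ∑ j, d j * normSq (y j) := by
    have e : ∀ (a : ℝ) (z : ℂ), star z * (a * z) = ((a * normSq z : ℝ) : ℂ) := by
      intro a z
      rw [ofReal_mul, normSq_eq_conj_mul_self, starRingEnd_apply]
      ring
    simp only [dotProduct, mulVec_diagonal, Pi.star_apply, e] at h1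
    exact_mod_cast h1
  have h3 : s * ∑ i, hN.eigenvalues i * normSq ((Q *ᵥ y) i) ≤ 0 := by
    rw [Finset.mul_sum]
    apply Finset.sum_nonpos
    intro i _
    by_cases hi : 0 < s * hN.eigenvalues i
    · simp [hz i hi]
    · rw [← mul_assoc]
      exact mul_nonpos_of_nonpos_of_nonneg (not_lt.1 hi) (normSq_nonneg _)
  have h4 : 0 < s * ∑ j, d j * normSq (y j) := by
    rw [Finset.mul_sum]
    obtain ⟨j, hj⟩ := Function.ne_iff.1 hy0
    refine Finset.sum_pos' (fun i _ => ?_) ⟨j, Finset.mem_univ _, ?_⟩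
    · rw [← mul_assoc]
      exact mul_nonneg (hd i).le (normSq_nonneg _)
    · rw [← mul_assoc]
      exact mul_pos (hd j) (normSq_pos.2 hj)
  rw [h2] at h3
  exact absurd h4 (not_lt.2 h3)

lemma omega_eq : ω = 1 / 2 + (Real.sqrt 3 / 2 : ℝ) * Complex.I := by
  unfold ω
  rw [show (Real.pi / 3 * Complex.I : ℂ) = ((Real.pi / 3 : ℝ) : ℂ) * Complex.I by push_cast; ring,
    Complex.exp_mul_I, ← Complex.ofReal_cos, ← Complex.ofReal_sin, Real.cos_pi_div_three,
    Real.sin_pi_div_three]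
  push_cast
  ring

lemma omega_conj : (starRingEnd ℂ) ω = 1 - ω := by
  have hre : ω.re = 1 / 2 := by rw [omega_eq]; simp
  apply Complex.ext
  · rw [Complex.conj_re, Complex.sub_re, Complex.one_re, hre]
    norm_num
  · simp

lemma omega_sq : ω * ω = ω - 1 := by
  have h : Real.sqrt 3 * Real.sqrt 3 = 3 := Real.mul_self_sqrt (by norm_num)
  rw [omega_eq]
  apply Complex.ext
  · simp
    nlinarith
  · simp
    ring

lemma M_eq (k : ℤ) : M k =
    !![-1, -(1-ω), 0, 0, -(1-ω), 0;
       -ω, -1, 0, 0, -(1-ω), 0;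
       0, 0, 1, 1-ω, 1-ω, 0;
       0, 0, ω, 1, 1-ω, 0;
       -ω, -ω, ω, ω, 0, ω;
       0, 0, 0, 0, 1-ω, -(k:ℂ)] := by
  unfold M A
  rw [omega_conj]
  ext i j
  fin_cases i <;> fin_cases j <;> simp <;> ring

theorem stmt_2 (k : ℤ) (hk : 2 ≤ k) (hM : (M k).IsHermitian) :
    signature hM = -1 := by
  have hkr : (0 : ℝ) < k := by exact_mod_cast (by omega : 0 < k)
  have hc := omega_conj
  have hs := omega_sq
  have hpos : 2 ≤ (univ.filter fun i => 0 < hM.eigenvalues i).card := by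
    have h := card_lower hM 1 !![0, -1 - (1 - ω); 0, ω; 1, -(1 - ω); 0, 0; 0, 1; 0, 0] ![1, 2]
      (by intro j; fin_cases j <;> simp)
      (by
        rw [M_eq]
        ext i j
        fin_cases i <;> fin_cases j <;>
          simp [Matrix.mul_apply, Fin.sum_univ_succ, hc] <;> grind)
    simpa using h
  have hneg : 3 ≤ (univ.filter fun i => hM.eigenvalues i < 0).card := by
    have h := card_lower hM (-1)
      !![1, 0, 1 - (1 - ω) * k; 0, 0, -ω; 0, 0, -(1 - ω) * k; 0, 0, 0; 0, 0, k; 0, 1, 1 - ω]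
      ![-1, -k, -k]
      (by intro j; fin_cases j <;> simp <;> exact_mod_cast hkr)
      (by
        rw [M_eq]
        ext i j
        fin_cases i <;> fin_cases j <;>
          simp [Matrix.mul_apply, Fin.sum_univ_succ, hc] <;> grind)
    simpa using h
  have hdet : (M k).det = 0 := by
    rw [← Matrix.exists_mulVec_eq_zero_iff]
    refine ⟨![-(1 - ω), 1, -(1 - ω), 1, 0, 0], fun h => by simpa using congrFun h 1, ?_⟩
    rw [M_eq]
    ext i
    fin_cases i <;> simp [Matrix.mulVec, dotProduct, Fin.sum_univ_succ] <;> grind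
  have hzero : 1 ≤ (univ.filter fun i => hM.eigenvalues i = 0).card := by
    rw [hM.det_eq_prod_eigenvalues, Finset.prod_eq_zero_iff] at hdet
    obtain ⟨i, _, hi⟩ := hdet
    exact Finset.card_pos.2 ⟨i, by simpa using hi⟩
  have hsum : (univ.filter fun i => 0 < hM.eigenvalues i).card +
      (univ.filter fun i => hM.eigenvalues i < 0).card +
      (univ.filter fun i => hM.eigenvalues i = 0).card = 6 := by
    rw [← Finset.card_union_of_disjoint, ← Finset.card_union_of_disjoint]
    · have : ((univ.filter fun i => 0 < hM.eigenvalues i) ∪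
          (univ.filter fun i => hM.eigenvalues i < 0)) ∪
          (univ.filter fun i => hM.eigenvalues i = 0) = univ := by
        ext i
        rcases lt_trichotomy (hM.eigenvalues i) 0 with h | h | h <;> simp [h]
      rw [this]
      simp
    · rw [Finset.disjoint_left]
      intro i
      simp only [Finset.mem_union, Finset.mem_filter, Finset.mem_univ, true_and]
      intro h h'
      rcases h with h | h <;> linarith
    · rw [Finset.disjoint_left]
      intro i
      simp only [Finset.mem_filter, Finset.mem_univ, true_and]
      intro h h'
      linarith
  unfold signature
  omega
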